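/- Let X, Y be compact metric spaces, f : X → X, g : Y → Y continuous maps, C a chain component of f, D ∈ 𝒟(C), C' a chain component of g, and let h : (C, f|_C) → (C', g|_{C'}) be a topological conjugacy (so h(D) ∈ 𝒟(C')). Let ℱ, 𝒢 be full Furstenberg families, n ≥ 2 and δ > 0. If g has the limit shadowing property and there exists an (ℱ,𝒢)-δ-scrambled n-tuple (a_1,…,a_n) ∈ [V^s(D)]^n for f, then there exist δ' > 0 and an (ℱ,𝒢)-δ'-scrambled n-tuple (b_1,…,b_n) ∈ [V^s(h(D))]^n for g. -/

import Mathlib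

open Filter Metric Set Topology

section Defs

variable {X : Type*} [MetricSpace X]

/-- A δ-chain of `f` of length `k` (with `k ≥ 1`) within the set `C`, from `x` to `y`. -/
def ChainIn (f : X → X) (C : Set X) (δ : ℝ) (k : ℕ) (x y : X) : Prop :=
  1 ≤ k ∧ ∃ c : ℕ → X, c 0 = x ∧ c k = y ∧ (∀ i ≤ k, c i ∈ C) ∧
    ∀ i < k, dist (f (c i)) (c (i + 1)) ≤ δ

/-- `x → y` : for every `δ > 0` there is a `δ`-chain of `f` from `x` to `y`. -/
def ChainReach (f : X → X) (x y : X) : Prop :=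
  ∀ δ > 0, ∃ k, ChainIn f Set.univ δ k x y

/-- `x` is chain recurrent for `f`. -/
def ChainRecurrent (f : X → X) (x : X) : Prop := ChainReach f x x

/-- `C` is a chain component of `f`: an equivalence class of the relation `↔`
on the set of chain recurrent points. -/
def IsChainComponent (f : X → X) (C : Set X) : Prop :=
  ∃ x, ChainRecurrent f x ∧
    C = {y | ChainRecurrent f y ∧ ChainReach f x y ∧ ChainReach f y x}

/-- The set of lengths of δ-cycles of `f` restricted to `C`. -/
def cycleLengths (f : X → X) (C : Set X) (δ : ℝ) : Set ℕ :=
  {k | ∃ x ∈ C, ChainIn f C δ k x x}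

/-- The greatest common divisor of a set of natural numbers
(the greatest natural number dividing every element). -/
noncomputable def setGcd (S : Set ℕ) : ℕ := sSup {d | ∀ k ∈ S, d ∣ k}

/-- `x ∼_{C,δ} y` : there is a δ-chain of `f|_C` from `x` to `y` whose length is
divisible by `m(C,δ)`, the gcd of the lengths of all δ-cycles of `f|_C`. -/
def SimCd (f : X → X) (C : Set X) (δ : ℝ) (x y : X) : Prop :=
  ∃ k, setGcd (cycleLengths f C δ) ∣ k ∧ ChainIn f C δ k x y

/-- `x ∼_C y` : `x ∼_{C,δ} y` for all `δ > 0`. -/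
def SimC (f : X → X) (C : Set X) (x y : X) : Prop :=
  ∀ δ > 0, SimCd f C δ x y

/-- `𝒟(C,δ)` : the set of equivalence classes of `∼_{C,δ}`. -/
def DClassesd (f : X → X) (C : Set X) (δ : ℝ) : Set (Set X) :=
  {D | ∃ x ∈ C, D = {y ∈ C | SimCd f C δ x y}}

/-- `𝒟(C)` : the set of equivalence classes of `∼_C`. -/
def DClasses (f : X → X) (C : Set X) : Set (Set X) :=
  {D | ∃ x ∈ C, D = {y ∈ C | SimC f C x y}}

/-- `W^s(C) = {x : lim_{i→∞} d(f^i(x), C) = 0}`. -/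
def wStable (f : X → X) (C : Set X) : Set X :=
  {x | Tendsto (fun i => infDist (f^[i] x) C) atTop (nhds 0)}

/-- `V^s(D) = ⋂_{δ>0} {x ∈ W^s(C) : lim_{i→∞} d(f^i(x), f^i(D_δ)) = 0}`, where
`D_δ` is the unique element of `𝒟(C,δ)` containing `D`. -/
def vStable (f : X → X) (C D : Set X) : Set X :=
  {x | x ∈ wStable f C ∧ ∀ δ > 0, ∀ Dd ∈ DClassesd f C δ, D ⊆ Dd →
    Tendsto (fun i => infDist (f^[i] x) (f^[i] '' Dd)) atTop (nhds 0)}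

/-- The s-limit shadowing property. -/
def SLimitShadowing (f : X → X) : Prop :=
  ∀ ε > 0, ∃ δ > 0, ∀ x : ℕ → X,
    (∀ i, dist (f (x i)) (x (i + 1)) ≤ δ) →
    Tendsto (fun i => dist (f (x i)) (x (i + 1))) atTop (nhds 0) →
    ∃ z : X, (∀ i, dist (f^[i] z) (x i) ≤ ε) ∧
      Tendsto (fun i => dist (f^[i] z) (x i)) atTop (nhds 0)

/-- The limit shadowing property. -/
def LimitShadowing (f : X → X) : Prop :=
  ∀ x : ℕ → X, Tendsto (fun i => dist (f (x i)) (x (i + 1))) atTop (nhds 0) →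
    ∃ z : X, Tendsto (fun i => dist (f^[i] z) (x i)) atTop (nhds 0)

/-- The (plain) shadowing property. -/
def ShadowingProperty (f : X → X) : Prop :=
  ∀ ε > 0, ∃ δ > 0, ∀ x : ℕ → X, (∀ i, dist (f (x i)) (x (i + 1)) ≤ δ) →
    ∃ z : X, ∀ i, dist (f^[i] z) (x i) ≤ ε

/-- A Furstenberg family: hereditary upward and proper. -/
def FurstenbergFamily (F : Set (Set ℕ)) : Prop :=
  (∀ A B : Set ℕ, A ∈ F → A ⊆ B → B ∈ F) ∧ F.Nonempty ∧ F ≠ Set.univ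

/-- A full Furstenberg family. -/
def FullFamily (F : Set (Set ℕ)) : Prop :=
  ∀ A ∈ F, ∀ n : ℕ, {i ∈ A | n ≤ i} ∈ F

/-- A translation invariant Furstenberg family. -/
def TranslationInvariantFamily (F : Set (Set ℕ)) : Prop :=
  ∀ A ∈ F, ∀ n : ℕ, ((fun i => i + n) '' A ∈ F ∧ {i | i + n ∈ A} ∈ F)

/-- `S_f(x₁,…,xₙ; r) = {i : min_{j<k} d(fⁱ(x_j), fⁱ(x_k)) > r}`. -/
def Sset (f : X → X) {n : ℕ} (x : Fin n → X) (r : ℝ) : Set ℕ :=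
  {i | ∀ j k : Fin n, j < k → r < dist (f^[i] (x j)) (f^[i] (x k))}

/-- `T_f(x₁,…,xₙ; r) = {i : max_{j<k} d(fⁱ(x_j), fⁱ(x_k)) < r}`. -/
def Tset (f : X → X) {n : ℕ} (x : Fin n → X) (r : ℝ) : Set ℕ :=
  {i | ∀ j k : Fin n, j < k → dist (f^[i] (x j)) (f^[i] (x k)) < r}

/-- `(x₁,…,xₙ)` is an `(ℱ,𝒢)`-δ-scrambled n-tuple for `f`. -/
def Scrambled (f : X → X) (F G : Set (Set ℕ)) (δ : ℝ) {n : ℕ} (x : Fin n → X) : Prop :=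
  Sset f x δ ∈ F ∧ ∀ ε > 0, Tset f x ε ∈ G

/-- `Y` is dense `(ℱ,𝒢)`-n-δ-chaotic for `f`: the `(ℱ,𝒢)`-δ-scrambled n-tuples in `Yⁿ`
form a dense subset of `Yⁿ`. -/
def DenseChaotic (f : X → X) (F G : Set (Set ℕ)) (n : ℕ) (δ : ℝ) (Y : Set X) : Prop :=
  {x : Fin n → X | ∀ j, x j ∈ Y} ⊆
    closure {x : Fin n → X | (∀ j, x j ∈ Y) ∧ Scrambled f F G δ x}

/-- `S` is a residual subset of the subspace `T`: it contains a countable intersection of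
dense open subsets of `T`. -/
def ResidualIn {α : Type*} [TopologicalSpace α] (T S : Set α) : Prop :=
  ∃ U : ℕ → Set α, (∀ i, IsOpen (U i)) ∧ (∀ i, T ⊆ closure (U i ∩ T)) ∧
    (⋂ i, U i) ∩ T ⊆ S

/-- `Y` is generic `(ℱ,𝒢)`-n-δ-chaotic for `f`: the `(ℱ,𝒢)`-δ-scrambled n-tuples in `Yⁿ`
form a residual subset of `Yⁿ`. -/
def GenericChaotic (f : X → X) (F G : Set (Set ℕ)) (n : ℕ) (δ : ℝ) (Y : Set X) : Prop :=
  ResidualIn {x : Fin n → X | ∀ j, x j ∈ Y}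
    {x : Fin n → X | (∀ j, x j ∈ Y) ∧ Scrambled f F G δ x}

/-- A Furstenberg family `F` is compatible with `(Z, g)`. -/
def CompatibleFamily {Z : Type*} [TopologicalSpace Z] (F : Set (Set ℕ)) (g : Z → Z) : Prop :=
  ∀ U : Set Z, IsOpen U → IsGδ {z | {i | g^[i] z ∈ U} ∈ F}

end Defs

section Chains

variable {X : Type*} [MetricSpace X] {f : X → X} {C : Set X} {δ δ' : ℝ} {k l : ℕ} {x y z : X}

theorem ChainIn.left_mem (h : ChainIn f C δ k x y) : x ∈ C := by
  obtain ⟨-, c, rfl, -, hc, -⟩ := h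
  exact hc 0 (Nat.zero_le _)

theorem ChainIn.right_mem (h : ChainIn f C δ k x y) : y ∈ C := by
  obtain ⟨-, c, -, rfl, hc, -⟩ := h
  exact hc k le_rfl

theorem ChainIn.mono (h : ChainIn f C δ k x y) (hδ : δ ≤ δ') : ChainIn f C δ' k x y := by
  obtain ⟨hk, c, h0, h1, hc, hs⟩ := h
  exact ⟨hk, c, h0, h1, hc, fun i hi => (hs i hi).trans hδ⟩

theorem chainIn_one (hx : x ∈ C) (hy : y ∈ C) (hxy : dist (f x) y ≤ δ) :
    ChainIn f C δ 1 x y := by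
  refine ⟨le_rfl, fun i => if i = 0 then x else y, by simp, by simp, ?_, ?_⟩
  · intro i _
    by_cases hi : i = 0 <;> simp [hi, hx, hy]
  · intro i hi
    obtain rfl : i = 0 := by omega
    simpa using hxy

theorem ChainIn.trans (h₁ : ChainIn f C δ k x y) (h₂ : ChainIn f C δ l y z) :
    ChainIn f C δ (k + l) x z := by
  obtain ⟨hk, c, hc0, hck, hc, hcs⟩ := h₁
  obtain ⟨hl, e, he0, hel, he, hes⟩ := h₂
  refine ⟨by omega, fun i => if i ≤ k then c i else e (i - k), by simpa using hc0, ?_, ?_, ?_⟩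
  · have : ¬ k + l ≤ k := by omega
    simp [this, hel]
  · intro i hi
    by_cases hik : i ≤ k
    · simpa [hik] using hc i hik
    · simpa [hik] using he (i - k) (by omega)
  · intro i hi
    rcases lt_trichotomy i k with hik | rfl | hik
    · have h1 : i + 1 ≤ k := hik
      simpa [hik.le, h1] using hcs i hik
    · simpa [hck, ← he0] using hes 0 hl
    · have h1 : ¬ i ≤ k := by omega
      have h2 : ¬ i + 1 ≤ k := by omega
      have h3 : i + 1 - k = (i - k) + 1 := by omega
      simpa [h1, h2, h3] using hes (i - k) (by omega)

theorem ChainIn.perturb_right (h : ChainIn f C δ k x y) (hz : z ∈ C) (hyz : dist y z ≤ δ') :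
    ChainIn f C (δ + δ') k x z := by
  obtain ⟨hk, c, h0, h1, hc, hs⟩ := h
  have hδ' : 0 ≤ δ' := dist_nonneg.trans hyz
  refine ⟨hk, fun i => if i = k then z else c i, ?_, by simp, ?_, ?_⟩
  · have : 0 ≠ k := by omega
    simp [this, h0]
  · intro i hi
    by_cases hik : i = k
    · simpa [hik] using hz
    · simpa [hik] using hc i hi
  · intro i hi
    have h2 := hs i hi
    by_cases hik : i + 1 = k
    · rw [hik, h1] at h2
      simp only [hi.ne, if_false, hik, if_true]
      exact (dist_triangle _ y _).trans (add_le_add h2 hyz)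
    · simp only [hi.ne, if_false, hik]
      linarith

theorem ChainIn.perturb_left (h : ChainIn f C δ k x y) (hz : z ∈ C)
    (hxz : dist (f z) (f x) ≤ δ') : ChainIn f C (δ + δ') k z y := by
  obtain ⟨hk, c, h0, h1, hc, hs⟩ := h
  have hδ' : 0 ≤ δ' := dist_nonneg.trans hxz
  refine ⟨hk, fun i => if i = 0 then z else c i, by simp, ?_, ?_, ?_⟩
  · have : k ≠ 0 := by omega
    simp [this, h1]
  · intro i hi
    by_cases hi0 : i = 0
    · simpa [hi0] using hz
    · simpa [hi0] using hc i hi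
  · intro i hi
    have h2 := hs i hi
    by_cases hi0 : i = 0
    · subst hi0
      rw [h0] at h2
      simp only [if_true, Nat.add_eq_zero_iff, one_ne_zero, and_false, if_false]
      linarith [dist_triangle (f z) (f x) (c (0 + 1))]
    · simp only [hi0, if_false, Nat.add_eq_zero_iff, false_and]
      linarith

/-- A chain splits at any interior point. -/
theorem exists_chainIn_split {c : ℕ → X} (hc : ∀ i ≤ k, c i ∈ C)
    (hs : ∀ i < k, dist (f (c i)) (c (i + 1)) ≤ δ) {i : ℕ} (hi0 : 0 < i) (hik : i < k) :
    ChainIn f C δ i (c 0) (c i) ∧ ChainIn f C δ (k - i) (c i) (c k) := by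
  refine ⟨⟨hi0, c, rfl, rfl, fun j hj => hc j (by omega), fun j hj => hs j (by omega)⟩,
    by omega, fun j => c (i + j), rfl, ?_, fun j hj => hc _ (by omega),
    fun j hj => hs (i + j) (by omega)⟩
  change c (i + (k - i)) = c k
  congr 1
  omega

theorem ChainIn.map {Y : Type*} [MetricSpace Y] {g : Y → Y} {h : X → Y}
    (hconj : ∀ x ∈ C, h (f x) = g (h x)) (hfC : MapsTo f C C)
    (hh : ∀ a ∈ C, ∀ b ∈ C, dist a b ≤ δ → dist (h a) (h b) ≤ δ')
    (hch : ChainIn f C δ k x y) : ChainIn g (h '' C) δ' k (h x) (h y) := by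
  obtain ⟨hk, c, h0, h1, hc, hs⟩ := hch
  refine ⟨hk, h ∘ c, by simp [h0], by simp [h1], fun i hi => mem_image_of_mem h (hc i hi), ?_⟩
  intro i hi
  have := hh _ (hfC (hc i hi.le)) _ (hc (i + 1) hi) (hs i hi)
  rwa [hconj _ (hc i hi.le)] at this

theorem ChainReach.trans (h₁ : ChainReach f x y) (h₂ : ChainReach f y z) : ChainReach f x z := by
  intro δ hδ
  obtain ⟨k, hk⟩ := h₁ δ hδ
  obtain ⟨l, hl⟩ := h₂ δ hδ
  exact ⟨k + l, hk.trans hl⟩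

theorem chainReach_apply (f : X → X) (x : X) : ChainReach f x (f x) := fun δ hδ =>
  ⟨1, chainIn_one (mem_univ _) (mem_univ _) (by simpa using hδ.le)⟩

theorem exists_dist_apply_le [CompactSpace X] (hf : Continuous f) {ε : ℝ} (hε : 0 < ε) :
    ∃ η > 0, ∀ a b, dist a b < η → dist (f a) (f b) ≤ ε := by
  obtain ⟨η, hη, h⟩ := Metric.uniformContinuous_iff.1
    (CompactSpace.uniformContinuous_of_continuous hf) ε hε
  exact ⟨η, hη, fun a b hab => (h hab).le⟩

/-- If points accumulating at `z` are reached from `x` by arbitrarily fine chains,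
then `z` is chain reachable from `x`. -/
theorem chainReach_of_approx_right
    (h : ∀ ε > 0, ∃ w, dist w z < ε ∧ ∃ k, ChainIn f univ ε k x w) : ChainReach f x z := by
  intro δ hδ
  obtain ⟨w, hw, k, hk⟩ := h (δ / 2) (half_pos hδ)
  exact ⟨k, add_halves δ ▸ hk.perturb_right (mem_univ _) hw.le⟩

theorem chainReach_of_approx_left [CompactSpace X] (hf : Continuous f)
    (h : ∀ ε > 0, ∃ w, dist w z < ε ∧ ∃ k, ChainIn f univ ε k w y) : ChainReach f z y := by
  intro δ hδ
  obtain ⟨η, hη, hfη⟩ := exists_dist_apply_le hf (half_pos hδ)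
  obtain ⟨w, hw, k, hk⟩ := h (min η (δ / 2)) (lt_min hη (half_pos hδ))
  exact ⟨k, add_halves δ ▸ (hk.mono (min_le_right _ _)).perturb_left (mem_univ _)
    (hfη _ _ (by rw [dist_comm]; exact hw.trans_le (min_le_left _ _)))⟩

theorem ChainReach.apply_left [CompactSpace X] (hf : Continuous f) (hxy : ChainReach f x y)
    (hyy : ChainReach f y y) : ChainReach f (f x) y := by
  intro δ hδ
  obtain ⟨η, hη, hfη⟩ := exists_dist_apply_le hf (half_pos hδ)
  have hm : 0 < min (η / 2) (δ / 2) := lt_min (half_pos hη) (half_pos hδ)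
  obtain ⟨k, hk⟩ := hxy _ hm
  obtain ⟨l, hl⟩ := hyy _ hm
  have hkl := hk.trans hl
  have hk1 := hk.1
  have hl1 := hl.1
  obtain ⟨-, c, h0, h1, hc, hs⟩ := hkl
  obtain ⟨h2, h3⟩ := exists_chainIn_split hc hs (i := 1) one_pos (by omega)
  have h4 : dist (f x) (c 1) < η := by
    have := (hs 0 (by omega)).trans (min_le_left _ _)
    rw [h0, zero_add] at this
    linarith
  rw [h1] at h3
  exact ⟨_, add_halves δ ▸ (h3.mono (min_le_right _ _)).perturb_left (mem_univ _) (hfη _ _ h4)⟩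

namespace IsChainComponent

theorem nonempty (hC : IsChainComponent f C) : C.Nonempty := by
  obtain ⟨x, hx, rfl⟩ := hC
  exact ⟨x, hx, hx, hx⟩

theorem chainReach (hC : IsChainComponent f C) (hx : x ∈ C) (hy : y ∈ C) : ChainReach f x y := by
  obtain ⟨w, -, rfl⟩ := hC
  exact hx.2.2.trans hy.2.1

theorem mem_of_chainReach (hC : IsChainComponent f C) (hx : x ∈ C) (hxz : ChainReach f x z)
    (hzx : ChainReach f z x) : z ∈ C := by
  obtain ⟨w, -, rfl⟩ := hC
  exact ⟨hzx.trans hxz, hx.2.1.trans hxz, hzx.trans hx.2.2⟩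

theorem mapsTo [CompactSpace X] (hf : Continuous f) (hC : IsChainComponent f C) :
    MapsTo f C C := fun x hx =>
  hC.mem_of_chainReach hx (chainReach_apply f x)
    ((hC.chainReach hx hx).apply_left hf (hC.chainReach hx hx))

theorem isClosed [CompactSpace X] (hf : Continuous f) (hC : IsChainComponent f C) :
    IsClosed C := by
  obtain ⟨x, hx⟩ := hC.nonempty
  refine isClosed_of_closure_subset fun z hz => hC.mem_of_chainReach hx ?_ ?_
  · refine chainReach_of_approx_right fun ε hε => ?_
    obtain ⟨w, hw, hzw⟩ := Metric.mem_closure_iff.1 hz ε hε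
    exact ⟨w, by rwa [dist_comm], hC.chainReach hx hw ε hε⟩
  · refine chainReach_of_approx_left hf fun ε hε => ?_
    obtain ⟨w, hw, hzw⟩ := Metric.mem_closure_iff.1 hz ε hε
    exact ⟨w, by rwa [dist_comm], hC.chainReach hw hx ε hε⟩

/-- Fine chains between two points of a chain component stay close to the component. -/
theorem exists_chain_infDist_lt [CompactSpace X] (hf : Continuous f) (hC : IsChainComponent f C)
    (hx : x ∈ C) (hy : y ∈ C) {ε : ℝ} (hε : 0 < ε) :
    ∃ η > 0, ∀ k (c : ℕ → X), c 0 = x → c k = y →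
      (∀ i < k, dist (f (c i)) (c (i + 1)) ≤ η) → ∀ i ≤ k, infDist (c i) C < ε := by
  by_contra! hcon
  have hpt : ∀ n : ℕ, ∃ z, ε ≤ infDist z C ∧ (∃ k, ChainIn f univ (1 / ((n : ℝ) + 1)) k x z) ∧
      ∃ k, ChainIn f univ (1 / ((n : ℝ) + 1)) k z y := by
    intro n
    obtain ⟨k, c, h0, h1, hs, i, hik, hi⟩ := hcon (1 / ((n : ℝ) + 1)) Nat.one_div_pos_of_nat
    have hi0 : i ≠ 0 := by
      rintro rfl
      rw [h0, infDist_zero_of_mem hx] at hi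
      exact hi.not_gt hε
    have hik' : i ≠ k := by
      rintro rfl
      rw [h1, infDist_zero_of_mem hy] at hi
      exact hi.not_gt hε
    obtain ⟨h2, h3⟩ := exists_chainIn_split (C := univ) (fun _ _ => mem_univ _) hs
      (Nat.pos_of_ne_zero hi0) (lt_of_le_of_ne hik hik')
    rw [h0] at h2
    rw [h1] at h3
    exact ⟨c i, hi, ⟨_, h2⟩, _, h3⟩
  choose u hu hxu huy using hpt
  obtain ⟨z, φ, hφ, hz⟩ := CompactSpace.tendsto_subseq u
  have hev : ∀ r > 0, ∃ n, dist (u n) z < r ∧ 1 / ((n : ℝ) + 1) ≤ r := by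
    intro r hr
    have h1 : ∀ᶠ n in atTop, 1 / ((φ n : ℝ) + 1) < r :=
      (tendsto_one_div_add_atTop_nhds_zero_nat.comp hφ.tendsto_atTop).eventually
        (gt_mem_nhds hr)
    obtain ⟨n, hn, hn'⟩ := ((Metric.tendsto_nhds.1 hz r hr).and h1).exists
    exact ⟨φ n, hn, hn'.le⟩
  have hxz : ChainReach f x z := chainReach_of_approx_right fun r hr => by
    obtain ⟨n, hn, hn'⟩ := hev r hr
    obtain ⟨k, hk⟩ := hxu n
    exact ⟨u n, hn, k, hk.mono hn'⟩
  have hzy : ChainReach f z y := chainReach_of_approx_left hf fun r hr => by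
    obtain ⟨n, hn, hn'⟩ := hev r hr
    obtain ⟨k, hk⟩ := huy n
    exact ⟨u n, hn, k, hk.mono hn'⟩
  have hzC : z ∈ C := hC.mem_of_chainReach hx hxz (hzy.trans (hC.chainReach hy hx))
  have hle : ε ≤ infDist z C :=
    ge_of_tendsto' (((continuous_infDist_pt C).tendsto z).comp hz) fun n => hu (φ n)
  rw [infDist_zero_of_mem hzC] at hle
  exact hle.not_gt hε

theorem exists_chainIn [CompactSpace X] (hf : Continuous f) (hC : IsChainComponent f C)
    (hx : x ∈ C) (hy : y ∈ C) (hδ : 0 < δ) : ∃ k, ChainIn f C δ k x y := by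
  obtain ⟨ε, hε, hfε⟩ := exists_dist_apply_le hf (show 0 < δ / 3 by positivity)
  obtain ⟨η, hη, hnear⟩ := hC.exists_chain_infDist_lt hf hx hy
    (show 0 < min ε (δ / 3) from lt_min hε (by positivity))
  obtain ⟨k, hk, c, h0, h1, -, hs⟩ := hC.chainReach hx hy (min η (δ / 3))
    (lt_min hη (by positivity))
  have hproj : ∀ i, ∃ p ∈ C, (c i ∈ C → p = c i) ∧ (i ≤ k → dist (c i) p < min ε (δ / 3)) := by
    intro i
    by_cases hci : c i ∈ C
    · exact ⟨c i, hci, fun _ => rfl, fun _ => by simpa using ⟨hε, hδ⟩⟩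
    · by_cases hik : i ≤ k
      · obtain ⟨p, hp, hd⟩ := (infDist_lt_iff hC.nonempty).1
          (hnear k c h0 h1 (fun i hi => (hs i hi).trans (min_le_left _ _)) i hik)
        exact ⟨p, hp, fun h => absurd h hci, fun _ => hd⟩
      · exact ⟨x, hx, fun h => absurd h hci, fun h => absurd h hik⟩
  choose p hpC hpc hpd using hproj
  refine ⟨k, hk, p, by rw [hpc 0 (h0 ▸ hx), h0], by rw [hpc k (h1 ▸ hy), h1],
    fun i _ => hpC i, fun i hi => ?_⟩
  have e1 : dist (f (p i)) (f (c i)) ≤ δ / 3 := hfε _ _ (by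
    rw [dist_comm]; exact (hpd i hi.le).trans_le (min_le_left _ _))
  have e2 := (hs i hi).trans (min_le_right _ _)
  have e3 := (hpd (i + 1) hi).trans_le (min_le_right _ _)
  linarith [dist_triangle4 (f (p i)) (f (c i)) (c (i + 1)) (p (i + 1))]

theorem surjOn [CompactSpace X] (hf : Continuous f) (hC : IsChainComponent f C) :
    SurjOn f C C := by
  intro y hy
  have hcl : IsClosed (f '' C) := ((hC.isClosed hf).isCompact.image hf).isClosed
  rw [← hcl.closure_eq, Metric.mem_closure_iff]
  intro ε hε
  obtain ⟨k, hk, c, -, h1, hc, hs⟩ := hC.exists_chainIn hf hy hy (half_pos hε)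
  refine ⟨f (c (k - 1)), mem_image_of_mem f (hc _ (by omega)), ?_⟩
  have := hs (k - 1) (by omega)
  rw [Nat.sub_add_cancel hk, h1] at this
  rw [dist_comm]
  linarith

end IsChainComponent

theorem bddAbove_commonDivisors {S : Set ℕ} (hk : k ∈ S) (hk0 : 1 ≤ k) :
    BddAbove {d | ∀ k ∈ S, d ∣ k} :=
  ⟨k, fun _ hd => Nat.le_of_dvd hk0 (hd k hk)⟩

theorem setGcd_mem {S : Set ℕ} (hk : k ∈ S) (hk0 : 1 ≤ k) :
    setGcd S ∈ {d | ∀ k ∈ S, d ∣ k} :=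
  Nat.sSup_mem ⟨1, fun _ _ => one_dvd _⟩ (bddAbove_commonDivisors hk hk0)

theorem dvd_setGcd {S : Set ℕ} (hk : k ∈ S) (hk0 : 1 ≤ k) {d : ℕ} (hd : ∀ k ∈ S, d ∣ k) :
    d ∣ setGcd S := by
  have h1 : Nat.lcm (setGcd S) d ≤ setGcd S :=
    le_csSup (bddAbove_commonDivisors hk hk0) fun j hj =>
      Nat.lcm_dvd (setGcd_mem hk hk0 j hj) (hd j hj)
  have h2 : 0 < setGcd S := Nat.pos_of_dvd_of_pos (setGcd_mem hk hk0 k hk) hk0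
  have h3 : Nat.lcm (setGcd S) d = setGcd S :=
    le_antisymm h1 (Nat.le_of_dvd (Nat.lcm_pos h2 (Nat.pos_of_dvd_of_pos (hd k hk) hk0))
      (Nat.dvd_lcm_left _ _))
  exact h3 ▸ Nat.dvd_lcm_right _ _

theorem ChainIn.setGcd_dvd (h : ChainIn f C δ k x x) : setGcd (cycleLengths f C δ) ∣ k :=
  have hk : k ∈ cycleLengths f C δ := ⟨x, h.left_mem, h⟩
  setGcd_mem hk h.1 k hk

theorem SimCd.right_mem (h : SimCd f C δ x y) : y ∈ C := h.choose_spec.2.right_mem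

theorem SimCd.trans (h₁ : SimCd f C δ x y) (h₂ : SimCd f C δ y z) : SimCd f C δ x z := by
  obtain ⟨k, hk, h₁⟩ := h₁
  obtain ⟨l, hl, h₂⟩ := h₂
  exact ⟨k + l, dvd_add hk hl, h₁.trans h₂⟩

/-- `δ`-chain transitivity of `f` on `C`. -/
def ChainTransitiveOn (f : X → X) (C : Set X) (δ : ℝ) : Prop :=
  ∀ x ∈ C, ∀ y ∈ C, ∃ k, ChainIn f C δ k x y

namespace ChainTransitiveOn

theorem simCd_refl (hC : ChainTransitiveOn f C δ) (hx : x ∈ C) : SimCd f C δ x x := by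
  obtain ⟨k, hk⟩ := hC x hx x hx
  exact ⟨k, hk.setGcd_dvd, hk⟩

/-- Points with a common successor at distance at most `δ` are equivalent. -/
theorem simCd_of_dist_le (hC : ChainTransitiveOn f C δ) (hfC : MapsTo f C C) (hδ : 0 ≤ δ)
    (hx : x ∈ C) (hy : y ∈ C) (h : dist (f x) (f y) ≤ δ) : SimCd f C δ x y := by
  obtain ⟨l, hl⟩ := hC (f y) (hfC hy) y hy
  exact ⟨1 + l, ((chainIn_one hy (hfC hy) (by simpa using hδ)).trans hl).setGcd_dvd,
    (chainIn_one hx (hfC hy) h).trans hl⟩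

theorem simCd_apply (hC : ChainTransitiveOn f C δ) (hfC : MapsTo f C C) (hδ : 0 ≤ δ)
    (h : SimCd f C δ x y) : SimCd f C δ (f x) (f y) := by
  obtain ⟨k, hk, h⟩ := h
  have hx := h.left_mem
  have hy := h.right_mem
  obtain ⟨l, hl⟩ := hC (f x) (hfC hx) x hx
  have h1 : setGcd (cycleLengths f C δ) ∣ l + 1 :=
    (hl.trans (chainIn_one hx (hfC hx) (by simpa using hδ))).setGcd_dvd
  refine ⟨l + k + 1, ?_, (hl.trans h).trans (chainIn_one hy (hfC hy) (by simpa using hδ))⟩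
  rw [add_right_comm]
  exact dvd_add h1 hk

theorem simCd_iterate (hC : ChainTransitiveOn f C δ) (hfC : MapsTo f C C) (hδ : 0 ≤ δ)
    (h : SimCd f C δ x y) (i : ℕ) : SimCd f C δ (f^[i] x) (f^[i] y) := by
  induction i with
  | zero => exact h
  | succ i ih =>
    rw [Function.iterate_succ_apply', Function.iterate_succ_apply']
    exact hC.simCd_apply hfC hδ ih

theorem exists_simCd_apply_eq (hC : ChainTransitiveOn f C δ) (hfC : MapsTo f C C)
    (hsurj : SurjOn f C C) (hδ : 0 ≤ δ) (hx : x ∈ C) (h : SimCd f C δ (f x) y) :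
    ∃ u, SimCd f C δ x u ∧ f u = y := by
  obtain ⟨k, hk, h⟩ := h
  obtain ⟨u, hu, rfl⟩ := hsurj h.right_mem
  obtain ⟨l, hl⟩ := hC x hx u hu
  obtain ⟨r, hr⟩ := hC (f u) (hfC hu) x hx
  have h1 := (((chainIn_one hx (hfC hx) (by simpa using hδ)).trans h).trans hr).setGcd_dvd
  have h2 := ((hl.trans (chainIn_one hu (hfC hu) (by simpa using hδ))).trans hr).setGcd_dvd
  refine ⟨u, ⟨l, ?_, hl⟩, rfl⟩
  have h3 : setGcd (cycleLengths f C δ) ∣ 1 + r := by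
    rw [show 1 + k + r = k + (1 + r) by ring] at h1
    exact (Nat.dvd_add_right hk).1 h1
  rw [add_assoc] at h2
  exact (Nat.dvd_add_left h3).1 h2

theorem exists_simCd_iterate_eq (hC : ChainTransitiveOn f C δ) (hfC : MapsTo f C C)
    (hsurj : SurjOn f C C) (hδ : 0 ≤ δ) (hx : x ∈ C) (i : ℕ) (h : SimCd f C δ (f^[i] x) y) :
    ∃ u, SimCd f C δ x u ∧ f^[i] u = y := by
  induction i generalizing y with
  | zero => exact ⟨y, h, rfl⟩
  | succ i ih =>
    rw [Function.iterate_succ_apply'] at h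
    obtain ⟨v, hv, rfl⟩ := hC.exists_simCd_apply_eq hfC hsurj hδ (hfC.iterate i hx) h
    obtain ⟨u, hu, rfl⟩ := ih hv
    exact ⟨u, hu, Function.iterate_succ_apply' _ _ _⟩

end ChainTransitiveOn

theorem SimCd.map {Y : Type*} [MetricSpace Y] {g : Y → Y} {h : X → Y}
    (hC : ChainTransitiveOn f C δ)
    (hconj : ∀ x ∈ C, h (f x) = g (h x)) (hfC : MapsTo f C C)
    (hh : ∀ a ∈ C, ∀ b ∈ C, dist a b ≤ δ → dist (h a) (h b) ≤ δ')
    (hxy : SimCd f C δ x y) : SimCd g (h '' C) δ' (h x) (h y) := by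
  obtain ⟨k, hk, hch⟩ := hxy
  obtain ⟨l, hl⟩ := hC x hch.left_mem x hch.left_mem
  have hmem : l ∈ cycleLengths f C δ := ⟨x, hl.left_mem, hl⟩
  refine ⟨k, (dvd_setGcd hmem hl.1 ?_).trans hk, hch.map hconj hfC hh⟩
  rintro j ⟨w, -, hw⟩
  exact (hw.map hconj hfC hh).setGcd_dvd

end Chains

section Transfer

variable {X Y : Type*} [MetricSpace X] [MetricSpace Y] {h : X → Y} {C : Set X}

theorem IsCompact.exists_dist_le_of_continuousOn (hC : IsCompact C) (hcont : ContinuousOn h C)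
    {ε : ℝ} (hε : 0 < ε) :
    ∃ η > 0, ∀ a ∈ C, ∀ b ∈ C, dist a b ≤ η → dist (h a) (h b) < ε := by
  obtain ⟨η, hη, H⟩ := Metric.uniformContinuousOn_iff.1
    (hC.uniformContinuousOn_of_continuous hcont) ε hε
  exact ⟨η / 2, half_pos hη, fun a ha b hb hab => H a ha b hb (by linarith)⟩

theorem IsCompact.exists_le_dist_of_injOn (hC : IsCompact C) (hcont : ContinuousOn h C)
    (hinj : InjOn h C) {ε : ℝ} (hε : 0 < ε) :
    ∃ η > 0, ∀ a ∈ C, ∀ b ∈ C, ε ≤ dist a b → η ≤ dist (h a) (h b) := by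
  have hK : IsCompact ((C ×ˢ C) ∩ {p : X × X | ε ≤ dist p.1 p.2}) :=
    (hC.prod hC).inter_right (isClosed_le continuous_const continuous_dist)
  have hc : ContinuousOn (fun p : X × X => dist (h p.1) (h p.2))
      ((C ×ˢ C) ∩ {p : X × X | ε ≤ dist p.1 p.2}) :=
    continuous_dist.comp_continuousOn
      ((hcont.comp continuousOn_fst fun _ hp => hp.1.1).prodMk
        (hcont.comp continuousOn_snd fun _ hp => hp.1.2))
  obtain ⟨η, hη, H⟩ := hK.exists_forall_le' hc (a := 0) fun p hp => dist_pos.2 fun heq => by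
    have h1 : ε ≤ dist p.1 p.2 := hp.2
    rw [hinj hp.1.1 hp.1.2 heq, dist_self] at h1
    exact h1.not_gt hε
  exact ⟨η, hη, fun a ha b hb hab => H (a, b) ⟨⟨ha, hb⟩, hab⟩⟩

theorem tendsto_dist_of_uniform {u v : ℕ → X} (hC : IsCompact C) (hcont : ContinuousOn h C)
    (hu : ∀ i, u i ∈ C) (hv : ∀ i, v i ∈ C)
    (huv : Tendsto (fun i => dist (u i) (v i)) atTop (𝓝 0)) :
    Tendsto (fun i => dist (h (u i)) (h (v i))) atTop (𝓝 0) := by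
  rw [Metric.tendsto_nhds]
  intro ε hε
  obtain ⟨η, hη, H⟩ := hC.exists_dist_le_of_continuousOn hcont hε
  filter_upwards [huv.eventually (gt_mem_nhds hη)] with i hi
  simpa using H _ (hu i) _ (hv i) hi.le

/-- The orbit of a point of `W^s(C)` is asymptotic to a sequence in `C`, which is then an
asymptotic pseudo-orbit. -/
theorem exists_asymptotic_seq [CompactSpace X] {f : X → X} (hf : Continuous f)
    (hC : IsCompact C) (hne : C.Nonempty) {a : X} (ha : a ∈ wStable f C) :
    ∃ u : ℕ → X, (∀ i, u i ∈ C) ∧ Tendsto (fun i => dist (f^[i] a) (u i)) atTop (𝓝 0) ∧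
      Tendsto (fun i => dist (f (u i)) (u (i + 1))) atTop (𝓝 0) := by
  choose u hu hd using fun i => hC.exists_infDist_eq_dist hne (f^[i] a)
  have hlim : Tendsto (fun i => dist (f^[i] a) (u i)) atTop (𝓝 0) := by
    simpa only [← hd, wStable, mem_ofPred_eq] using ha
  refine ⟨u, hu, hlim, ?_⟩
  have h1 : Tendsto (fun i => dist (f (f^[i] a)) (f (u i))) atTop (𝓝 0) :=
    tendsto_dist_of_uniform isCompact_univ hf.continuousOn (fun _ => mem_univ _)
      (fun _ => mem_univ _) hlim
  have h2 := h1.add (hlim.comp (tendsto_add_atTop_nat 1))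
  rw [add_zero] at h2
  refine squeeze_zero (fun _ => dist_nonneg) (fun i => ?_) h2
  simp only [Function.comp, Function.iterate_succ_apply']
  rw [dist_comm (f (f^[i] a)) (f (u i))]
  exact dist_triangle _ _ _

/-- Replacing an orbit in `V^s(D)` by an asymptotic sequence in `C`, and the image of that
sequence by an asymptotic orbit, yields a point of `V^s(h(D))`. -/
theorem mem_vStable_image [CompactSpace X] [CompactSpace Y] {f : X → X} {g : Y → Y}
    (hf : Continuous f) (hg : Continuous g) (hC : IsChainComponent f C) {D : Set X}
    (hD : D ∈ DClasses f C) (hC' : IsChainComponent g (h '' C)) (hcont : ContinuousOn h C)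
    (hconj : ∀ x ∈ C, h (f x) = g (h x)) {a : X} (ha : a ∈ vStable f C D) {u : ℕ → X}
    (hu : ∀ i, u i ∈ C) (hau : Tendsto (fun i => dist (f^[i] a) (u i)) atTop (𝓝 0)) {b : Y}
    (hb : Tendsto (fun i => dist (g^[i] b) (h (u i))) atTop (𝓝 0)) :
    b ∈ vStable g (h '' C) (h '' D) := by
  have hfC := hC.mapsTo hf
  have hgC := hC'.mapsTo hg
  have hCc := (hC.isClosed hf).isCompact
  obtain ⟨x₀, hx₀, rfl⟩ := hD
  refine ⟨squeeze_zero (fun _ => infDist_nonneg)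
    (fun i => infDist_le_dist_of_mem (mem_image_of_mem h (hu i))) hb, ?_⟩
  rintro δ' hδ' _ ⟨x', hx', rfl⟩ hsub
  obtain ⟨δ, hδ, hh⟩ := hCc.exists_dist_le_of_continuousOn hcont hδ'
  have hft : ∀ r > 0, ChainTransitiveOn f C r := fun r hr x hx y hy =>
    hC.exists_chainIn hf hx hy hr
  have hgt : ChainTransitiveOn g (h '' C) δ' := fun x hx y hy => hC'.exists_chainIn hg hx hy hδ'
  have hx₀' : SimCd g (h '' C) δ' x' (h x₀) :=
    (hsub (mem_image_of_mem h ⟨hx₀, fun r hr => (hft r hr).simCd_refl hx₀⟩)).2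
  obtain ⟨η, hη, hfη⟩ := exists_dist_apply_le hf hδ
  have hlim := ha.2 δ hδ {y ∈ C | SimCd f C δ x₀ y} ⟨x₀, hx₀, rfl⟩
    fun y hy => ⟨hy.1, hy.2 δ hδ⟩
  have hne : {y ∈ C | SimCd f C δ x₀ y}.Nonempty := ⟨x₀, hx₀, (hft δ hδ).simCd_refl hx₀⟩
  have hiter : ∀ i, ∀ x ∈ C, h (f^[i] x) = g^[i] (h x) := by
    intro i x hx
    induction i with
    | zero => rfl
    | succ i ih =>
      rw [Function.iterate_succ_apply', Function.iterate_succ_apply',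
        hconj _ (hfC.iterate i hx), ih]
  have hmem : ∀ᶠ i in atTop,
      h (u i) ∈ g^[i] '' {y ∈ h '' C | SimCd g (h '' C) δ' x' y} := by
    filter_upwards [hlim.eventually (gt_mem_nhds (half_pos hη)),
      hau.eventually (gt_mem_nhds (half_pos hη))] with i hi₁ hi₂
    obtain ⟨_, ⟨w, ⟨hwC, hw⟩, rfl⟩, hwd⟩ := (infDist_lt_iff
      (Set.Nonempty.image _ hne)).1 hi₁
    have hdist : dist (f^[i] w) (u i) < η := by
      rw [dist_comm] at hwd
      linarith [dist_triangle (f^[i] w) (f^[i] a) (u i)]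
    have h1 : SimCd f C δ (f^[i] x₀) (u i) :=
      ((hft δ hδ).simCd_iterate hfC hδ.le hw i).trans
        ((hft δ hδ).simCd_of_dist_le hfC hδ.le (hfC.iterate i hwC) (hu i) (hfη _ _ hdist))
    have h2 := h1.map (hft δ hδ) hconj hfC fun a ha b hb hab => (hh a ha b hb hab).le
    rw [hiter i x₀ hx₀] at h2
    obtain ⟨v, hv, hvu⟩ := hgt.exists_simCd_iterate_eq hgC (hC'.surjOn hg) hδ'.le
      (mem_image_of_mem h hx₀) i h2
    exact ⟨v, ⟨hv.right_mem, hx₀'.trans hv⟩, hvu⟩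
  exact squeeze_zero' (Eventually.of_forall fun _ => infDist_nonneg)
    (hmem.mono fun i hi => infDist_le_dist_of_mem hi) hb

end Transfer

/-- Theorem 1.3: transferring a scrambled tuple through a topological conjugacy
`h : (C, f|_C) → (C', g|_{C'})`, assuming `g` has the limit shadowing property. -/
theorem scrambled_tuple_transfer_of_conjugacy
    {X Y : Type*} [MetricSpace X] [CompactSpace X] [MetricSpace Y] [CompactSpace Y]
    (f : X → X) (g : Y → Y) (hf : Continuous f) (hg : Continuous g)
    (C : Set X) (hC : IsChainComponent f C) (D : Set X) (hD : D ∈ DClasses f C)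
    (C' : Set Y) (hC' : IsChainComponent g C')
    (h : X → Y) (hcont : ContinuousOn h C) (hinj : Set.InjOn h C) (himg : h '' C = C')
    (hconj : ∀ x ∈ C, h (f x) = g (h x))
    (F G : Set (Set ℕ)) (hF : FurstenbergFamily F) (hFfull : FullFamily F)
    (hG : FurstenbergFamily G) (hGfull : FullFamily G)
    (n : ℕ) (hn : 2 ≤ n) (δ : ℝ) (hδ : 0 < δ)
    (hls : LimitShadowing g)
    (a : Fin n → X) (ha : ∀ j, a j ∈ vStable f C D) (hsc : Scrambled f F G δ a) :
    ∃ δ' > 0, ∃ b : Fin n → Y,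
      (∀ j, b j ∈ vStable g C' (h '' D)) ∧ Scrambled g F G δ' b := by
  subst himg
  have hCc := (hC.isClosed hf).isCompact
  choose u huC hau hpo using fun j => exists_asymptotic_seq hf hCc hC.nonempty (ha j).1
  have hgpo : ∀ j, Tendsto (fun i => dist (g (h (u j i))) (h (u j (i + 1)))) atTop (𝓝 0) := by
    intro j
    have := tendsto_dist_of_uniform hCc hcont (fun i => hC.mapsTo hf (huC j i))
      (fun i => huC j (i + 1)) (hpo j)
    simpa only [hconj _ (huC j _)] using this
  choose b hb using fun j => hls (fun i => h (u j i)) (hgpo j)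
  have hN : ∀ r > 0, ∃ N, ∀ i ≥ N, ∀ j,
      dist (f^[i] (a j)) (u j i) < r ∧ dist (g^[i] (b j)) (h (u j i)) < r := fun r hr =>
    eventually_atTop.1 (eventually_all.2 fun j =>
      ((hau j).eventually (gt_mem_nhds hr)).and ((hb j).eventually (gt_mem_nhds hr)))
  obtain ⟨η, hη, hsep⟩ := hCc.exists_le_dist_of_injOn hcont hinj (half_pos hδ)
  refine ⟨η / 4, by positivity, b,
    fun j => mem_vStable_image hf hg hC hD hC' hcont hconj (ha j) (huC j) (hau j) (hb j), ?_, ?_⟩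
  · obtain ⟨N, hN⟩ := hN (min (δ / 4) (η / 4)) (by positivity)
    refine hF.1 _ _ (hFfull _ hsc.1 N) ?_
    rintro i ⟨hi, hiN⟩ j k hjk
    have h1 := hi j k hjk
    obtain ⟨hj1, hj2⟩ := hN i hiN j
    obtain ⟨hk1, hk2⟩ := hN i hiN k
    rw [lt_min_iff] at hj1 hj2 hk1 hk2
    have h2 := hsep _ (huC j i) _ (huC k i) (by
      linarith [dist_triangle4 (f^[i] (a j)) (u j i) (u k i) (f^[i] (a k)),
        dist_comm (u k i) (f^[i] (a k))])
    linarith [dist_triangle4 (h (u j i)) (g^[i] (b j)) (g^[i] (b k)) (h (u k i)),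
      dist_comm (h (u j i)) (g^[i] (b j))]
  · intro ε hε
    obtain ⟨ρ, hρ, hclose⟩ := hCc.exists_dist_le_of_continuousOn hcont
      (show 0 < ε / 3 by positivity)
    obtain ⟨N, hN⟩ := hN (min (ρ / 3) (ε / 3)) (by positivity)
    refine hG.1 _ _ (hGfull _ (hsc.2 (ρ / 3) (by positivity)) N) ?_
    rintro i ⟨hi, hiN⟩ j k hjk
    have h1 := hi j k hjk
    obtain ⟨hj1, hj2⟩ := hN i hiN j
    obtain ⟨hk1, hk2⟩ := hN i hiN k
    rw [lt_min_iff] at hj1 hj2 hk1 hk2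
    have h2 := hclose _ (huC j i) _ (huC k i) (by
      linarith [dist_triangle4 (u j i) (f^[i] (a j)) (f^[i] (a k)) (u k i),
        dist_comm (u j i) (f^[i] (a j))])
    linarith [dist_triangle4 (g^[i] (b j)) (h (u j i)) (h (u k i)) (g^[i] (b k)),
      dist_comm (h (u k i)) (g^[i] (b k))]
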